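/- There exists a sequence λ = (λ_{IJ}) indexed by pairs of dyadic intervals such that ‖λ‖_X < ∞ but ‖λ‖_{X'} = ∞; equivalently, the mixed bi-parameter paraproduct P_λ is bounded on L²(ℝ²) while the paraproduct P_{|λ|} with coefficients |λ_{IJ}| is unbounded, so conditional boundedness does not imply unconditional boundedness. -/

import Mathlib

open MeasureTheory
open scoped ENNReal

noncomputable section

/-- A sequence `λ = (λ_{IJ})` indexed by pairs of dyadic intervals; a dyadic interval
`[2^{-i}k, 2^{-i}(k+1))` is encoded by the pair `(i, k) : ℤ × ℤ`. -/
abbrev ParaSeq := (ℤ × ℤ) → (ℤ × ℤ) → ℝ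

/-- The dyadic interval `[2^{-i} k, 2^{-i}(k+1))` encoded by the pair `p = (i, k) : ℤ × ℤ`. -/
def dyadic (p : ℤ × ℤ) : Set ℝ := Set.Ico ((2:ℝ) ^ (-p.1) * p.2) ((2:ℝ) ^ (-p.1) * (p.2 + 1))

/-- The length `|I| = 2^{-i}` of the dyadic interval encoded by `p = (i, k)`. -/
def dlen (p : ℤ × ℤ) : ℝ := (2:ℝ) ^ (-p.1)

/-- The average `⟨f⟩_I = |I|⁻¹ ∫_I f`. -/
def avg (f : ℝ → ℝ) (p : ℤ × ℤ) : ℝ := (dlen p)⁻¹ * ∫ x in dyadic p, f x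

/-- Admissible families `(u_I)_{I ∈ D}` of `L²(ℝ)` functions: only finitely many nonzero
members and `Σ_I ‖u_I‖₂² = 1`. -/
def Adm : Set ((ℤ × ℤ) → ℝ → ℝ) :=
  {u | (∀ p, MemLp (u p) 2 volume) ∧ {p | u p ≠ 0}.Finite ∧ (∑' p : ℤ × ℤ, ∫ x, (u p x) ^ 2) = 1}

/-- The bilinear sum `Σ_{I,J} λ_{IJ} ⟨g_J⟩_I ⟨u_I⟩_J`. -/
def pairSum (lam : ParaSeq) (u g : (ℤ × ℤ) → ℝ → ℝ) : ℝ :=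
  ∑' pq : (ℤ × ℤ) × (ℤ × ℤ), lam pq.1 pq.2 * avg (g pq.2) pq.1 * avg (u pq.1) pq.2

/-- The norm `‖λ‖_X`, as an element of `[0, ∞]`. -/
def Xnorm (lam : ParaSeq) : ℝ≥0∞ :=
  ⨆ (u : Adm) (g : Adm), ENNReal.ofReal |pairSum lam u.1 g.1|

/-- The norm `‖λ‖_{X'}`, as an element of `[0, ∞]`. -/
def Xprime (lam : ParaSeq) : ℝ≥0∞ :=
  ⨆ (u : Adm) (g : Adm),
    ENNReal.ofReal
      (∑' pq : (ℤ × ℤ) × (ℤ × ℤ), |lam pq.1 pq.2 * avg (g.1 pq.2) pq.1 * avg (u.1 pq.1) pq.2|)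

/-- The Walsh sign `(-1) ^ #(a ∩ b)`. -/
def walshSign (a b : Finset ℕ) : ℝ := ∏ k ∈ b, if k ∈ a then -1 else 1

theorem abs_walshSign (a b : Finset ℕ) : |walshSign a b| = 1 := by
  rw [walshSign, Finset.abs_prod]
  refine Finset.prod_eq_one fun k _ => ?_
  split_ifs <;> simp

theorem sum_walshSign_mul_walshSign {s a a' : Finset ℕ} (ha : a ⊆ s) (ha' : a' ⊆ s) :
    ∑ b ∈ s.powerset, walshSign a b * walshSign a' b = if a = a' then 2 ^ s.card else 0 := by
  simp only [walshSign, ← Finset.prod_mul_distrib]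
  rw [← Finset.prod_one_add]
  split_ifs with h
  · subst h
    rw [← Finset.prod_const]
    refine Finset.prod_congr rfl fun k _ => ?_
    split_ifs <;> norm_num
  · obtain ⟨k, hk⟩ : ∃ k, ¬(k ∈ a ↔ k ∈ a') := by
      by_contra! hc
      exact h (Finset.ext hc)
    refine Finset.prod_eq_zero (i := k) ?_ ?_
    · by_cases hka : k ∈ a
      · exact ha hka
      · exact ha' (by tauto)
    · by_cases hka : k ∈ a <;> by_cases hka' : k ∈ a' <;> simp_all

/-- The block diagonal matrix whose `n`-th block is the normalized Walsh matrix indexed by the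
subsets of `{0, …, 2n - 1}`. -/
def walshBlock (t t' : ℕ × Finset ℕ) : ℝ :=
  if t.1 = t'.1 ∧ t.2 ⊆ Finset.range (2 * t.1) ∧ t'.2 ⊆ Finset.range (2 * t.1) then
    (2 ^ t.1)⁻¹ * walshSign t.2 t'.2 else 0

theorem sum_walshBlock_mul_walshBlock {K : ℕ} {t₁ t₂ : ℕ × Finset ℕ} (h : t₁.1 < K) :
    ∑ t ∈ Finset.range K ×ˢ (Finset.range (2 * K)).powerset, walshBlock t₁ t * walshBlock t₂ t =
      if t₁ = t₂ ∧ t₁.2 ⊆ Finset.range (2 * t₁.1) then 1 else 0 := by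
  obtain ⟨n, a⟩ := t₁
  obtain ⟨n', a'⟩ := t₂
  simp only at h
  rw [Finset.sum_product, Finset.sum_eq_single_of_mem n (by simpa using h)]
  · by_cases hn : n' = n ∧ a ⊆ Finset.range (2 * n) ∧ a' ⊆ Finset.range (2 * n)
    · obtain ⟨rfl, ha, ha'⟩ := hn
      have hsub : (Finset.range (2 * n')).powerset ⊆ (Finset.range (2 * K)).powerset :=
        Finset.powerset_mono.2 (Finset.range_subset_range.2 (by omega))
      rw [← Finset.sum_subset hsub]
      · have : ∀ b ∈ (Finset.range (2 * n')).powerset,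
            walshBlock (n', a) (n', b) * walshBlock (n', a') (n', b) =
              ((2 ^ n')⁻¹ * (2 ^ n')⁻¹) * (walshSign a b * walshSign a' b) := by
          intro b hb
          simp only [walshBlock, ha, ha', Finset.mem_powerset.1 hb, and_self, if_true]
          ring
        rw [Finset.sum_congr rfl this, ← Finset.mul_sum, sum_walshSign_mul_walshSign ha ha']
        by_cases haa : a = a'
        · simp only [haa, ha', and_self, if_true, Finset.card_range]
          rw [two_mul, pow_add]
          field_simp
        · simp [haa]
      · intro b _ hb
        simp only [Finset.mem_powerset] at hb
        simp [walshBlock, hb]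
    · rw [if_neg]
      · refine Finset.sum_eq_zero fun b _ => ?_
        simp only [walshBlock]
        by_cases h1 : a ⊆ Finset.range (2 * n)
        · by_cases h2 : n' = n
          · subst h2
            have : ¬ a' ⊆ Finset.range (2 * n') := by tauto
            simp [this]
          · simp [h2]
        · simp [h1]
      · rintro ⟨h1, h2⟩
        simp only [Prod.mk.injEq] at h1
        obtain ⟨rfl, rfl⟩ := h1
        exact hn ⟨rfl, h2, h2⟩
  · intro c _ hc
    refine Finset.sum_eq_zero fun b _ => ?_
    simp [walshBlock, hc.symm]

theorem abs_sum_walshBlock_le {ι : Type*} (S : Finset ι) (f : ι → ℕ × Finset ℕ) (x y : ι → ℝ)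
    (hx : ∀ p ∈ S, ∀ q ∈ S, x p ≠ 0 → x q ≠ 0 → f p = f q → p = q)
    (hy : ∀ p ∈ S, ∀ q ∈ S, y p ≠ 0 → y q ≠ 0 → f p = f q → p = q) :
    |∑ p ∈ S, ∑ q ∈ S, walshBlock (f p) (f q) * x p * y q| ≤
      (∑ p ∈ S, x p ^ 2 + ∑ q ∈ S, y q ^ 2) / 2 := by
  classical
  obtain ⟨K, hK⟩ : ∃ K, ∀ p ∈ S, f p ∈ Finset.range K ×ˢ (Finset.range (2 * K)).powerset := by
    refine ⟨(∑ p ∈ S, ((f p).1 + ∑ k ∈ (f p).2, k)) + 1, fun p hp => ?_⟩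
    have h1 := Finset.single_le_sum (f := fun p => (f p).1 + ∑ k ∈ (f p).2, k)
      (fun _ _ => Nat.zero_le _) hp
    simp only [Finset.mem_product, Finset.mem_range, Finset.mem_powerset]
    refine ⟨by omega, fun k hk => ?_⟩
    have h2 := Finset.single_le_sum (f := fun k : ℕ => k) (fun _ _ => Nat.zero_le _) hk
    rw [Finset.mem_range]
    omega
  set U := Finset.range K ×ˢ (Finset.range (2 * K)).powerset with hU
  let z : ℕ × Finset ℕ → ℝ := fun t => ∑ p ∈ S, walshBlock (f p) t * x p
  have hz : ∑ t ∈ U, z t ^ 2 ≤ ∑ p ∈ S, x p ^ 2 := by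
    have h1 : ∑ t ∈ U, z t ^ 2 = ∑ p ∈ S, ∑ q ∈ S,
        x p * x q * ∑ t ∈ U, walshBlock (f p) t * walshBlock (f q) t := by
      simp only [z, sq, Finset.sum_mul_sum]
      simp only [Finset.mul_sum]
      rw [Finset.sum_comm]
      refine Finset.sum_congr rfl fun p _ => ?_
      rw [Finset.sum_comm]
      refine Finset.sum_congr rfl fun q _ => Finset.sum_congr rfl fun t _ => ?_
      ring
    rw [h1]
    refine Finset.sum_le_sum fun p hp => ?_
    rw [Finset.sum_eq_single_of_mem p hp]
    · rw [sum_walshBlock_mul_walshBlock (by simpa using (Finset.mem_product.1 (hK p hp)).1)]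
      split_ifs <;> nlinarith [sq_nonneg (x p)]
    · intro q hq hqp
      rw [sum_walshBlock_mul_walshBlock (by simpa using (Finset.mem_product.1 (hK p hp)).1)]
      by_cases h0 : x p = 0
      · simp [h0]
      by_cases h0' : x q = 0
      · simp [h0']
      rw [if_neg, mul_zero]
      rintro ⟨h, -⟩
      exact hqp (hx p hp q hq h0 h0' h).symm
  have hyz : ∑ q ∈ S.filter (fun q => y q ≠ 0), z (f q) ^ 2 ≤ ∑ t ∈ U, z t ^ 2 := by
    rw [← Finset.sum_image (s := S.filter (fun q => y q ≠ 0)) (g := f) (f := fun t => z t ^ 2)]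
    · refine Finset.sum_le_sum_of_subset_of_nonneg ?_ fun _ _ _ => sq_nonneg _
      intro t ht
      obtain ⟨q, hq, rfl⟩ := Finset.mem_image.1 ht
      exact hK q (Finset.mem_filter.1 hq).1
    · intro p hp q hq h
      simp only [Finset.coe_filter, Set.mem_ofPred_eq] at hp hq
      exact hy p hp.1 q hq.1 hp.2 hq.2 h
  have hsum : ∑ p ∈ S, ∑ q ∈ S, walshBlock (f p) (f q) * x p * y q =
      ∑ q ∈ S, z (f q) * y q := by
    rw [Finset.sum_comm]
    simp only [z, Finset.sum_mul]
  calc |∑ p ∈ S, ∑ q ∈ S, walshBlock (f p) (f q) * x p * y q|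
      ≤ ∑ q ∈ S, |z (f q) * y q| := hsum ▸ Finset.abs_sum_le_sum_abs _ _
    _ ≤ ∑ q ∈ S, ((if y q ≠ 0 then z (f q) ^ 2 else 0) + y q ^ 2) / 2 := by
        refine Finset.sum_le_sum fun q _ => ?_
        split_ifs with h
        · rw [abs_mul, ← sq_abs (z _), ← sq_abs (y _)]
          nlinarith [sq_nonneg (|z (f q)| - |y q|)]
        · simp only [not_not] at h
          simp [h]
    _ = (∑ q ∈ S.filter (fun q => y q ≠ 0), z (f q) ^ 2 + ∑ q ∈ S, y q ^ 2) / 2 := by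
        rw [← Finset.sum_div, Finset.sum_add_distrib, Finset.sum_filter]
    _ ≤ _ := by linarith

theorem dlen_pos (p : ℤ × ℤ) : 0 < dlen p := zpow_pos two_pos _

theorem measurableSet_dyadic (p : ℤ × ℤ) : MeasurableSet (dyadic p) := measurableSet_Ico

theorem volume_dyadic (p : ℤ × ℤ) : volume (dyadic p) = ENNReal.ofReal (dlen p) := by
  rw [dyadic, Real.volume_Ico, dlen]
  congr 1
  ring

theorem integrableOn_dyadic {f : ℝ → ℝ} (hf : MemLp f 2 volume) (p : ℤ × ℤ) :
    IntegrableOn f (dyadic p) := by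
  have : IsFiniteMeasure (volume.restrict (dyadic p)) :=
    ⟨by simp [volume_dyadic]⟩
  exact (hf.restrict _).integrable one_le_two

theorem eq_of_mem_dyadic {p q : ℤ × ℤ} {x : ℝ} (hp : x ∈ dyadic p) (hq : x ∈ dyadic q)
    (h : p.1 = q.1) : p = q := by
  obtain ⟨i, k⟩ := p
  obtain ⟨j, l⟩ := q
  obtain rfl : i = j := h
  simp only [dyadic, Set.mem_Ico] at hp hq
  have h2 : (0 : ℝ) < 2 ^ (-i) := zpow_pos two_pos _
  have h3 : (k : ℝ) < l + 1 := lt_of_mul_lt_mul_left (hp.1.trans_lt hq.2) h2.le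
  have h4 : (l : ℝ) < k + 1 := lt_of_mul_lt_mul_left (hq.1.trans_lt hp.2) h2.le
  have h5 : k < l + 1 := by exact_mod_cast h3
  have h6 : l < k + 1 := by exact_mod_cast h4
  rw [show k = l by omega]

theorem avg_zero (p : ℤ × ℤ) : avg 0 p = 0 := by simp [avg]

/-- An injective labelling of the nonnegative levels by indices of `walshBlock`. -/
def levelLabel (i : ℤ) : ℕ × Finset ℕ := (Denumerable.eqv (ℕ × Finset ℕ)).symm i.toNat

theorem levelLabel_inj {i j : ℤ} (hi : 0 ≤ i) (hj : 0 ≤ j) (h : levelLabel i = levelLabel j) :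
    i = j := by
  have := (Denumerable.eqv (ℕ × Finset ℕ)).symm.injective h
  omega

/-- The weight `|I| ^ (1 / 2)` if `|I| ≤ 1`, and `0` otherwise. -/
def dyadicWeight (p : ℤ × ℤ) : ℝ := if 0 ≤ p.1 then √(dlen p) else 0

theorem dyadicWeight_nonneg (p : ℤ × ℤ) : 0 ≤ dyadicWeight p := by
  unfold dyadicWeight
  split_ifs <;> positivity

theorem dyadicWeight_sq_le (p : ℤ × ℤ) : dyadicWeight p ^ 2 ≤ dlen p := by
  unfold dyadicWeight
  split_ifs
  · rw [Real.sq_sqrt (dlen_pos p).le]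
  · simpa using (dlen_pos p).le

/-- The sequence `λ_{IJ} = |I| ^ (1 / 2) |J| ^ (1 / 2) m_{ij}`, where `m` is a block diagonal
Walsh matrix evaluated at the levels of `I` and `J`. -/
def walshSeq : ParaSeq := fun p q =>
  dyadicWeight p * dyadicWeight q * walshBlock (levelLabel p.1) (levelLabel q.1)

theorem pairSum_eq_sum (lam : ParaSeq) {u g : (ℤ × ℤ) → ℝ → ℝ} {S : Finset (ℤ × ℤ)}
    (hu : ∀ p, p ∉ S → u p = 0) (hg : ∀ p, p ∉ S → g p = 0) :
    pairSum lam u g = ∑ p ∈ S, ∑ q ∈ S, lam p q * avg (g q) p * avg (u p) q := by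
  rw [pairSum, tsum_eq_sum (s := S ×ˢ S), Finset.sum_product]
  rintro ⟨p, q⟩ hpq
  rw [Finset.mem_product, not_and_or] at hpq
  rcases hpq with h | h
  · simp [hu p h, avg_zero]
  · simp [hg q h, avg_zero]

theorem sum_integral_sq_eq_one {u : (ℤ × ℤ) → ℝ → ℝ} (hu : u ∈ Adm) {S : Finset (ℤ × ℤ)}
    (hS : ∀ p, p ∉ S → u p = 0) : ∑ p ∈ S, ∫ x, u p x ^ 2 = 1 := by
  rw [← hu.2.2, tsum_eq_sum]
  intro p hp
  simp [hS p hp]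

theorem integral_indicator_dyadic (p : ℤ × ℤ) :
    ∫ x, (dyadic p).indicator (1 : ℝ → ℝ) x = dlen p := by
  rw [integral_indicator_one (measurableSet_dyadic p), measureReal_def, volume_dyadic,
    ENNReal.toReal_ofReal (dlen_pos p).le]

theorem integrable_indicator_dyadic (p : ℤ × ℤ) :
    Integrable ((dyadic p).indicator (1 : ℝ → ℝ)) :=
  (integrable_indicator_iff (measurableSet_dyadic p)).2
    (integrableOn_const (by simp [volume_dyadic]))

theorem dyadicWeight_mul_le (p : ℤ × ℤ) {a : ℝ} (ha : 0 ≤ a) :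
    (dyadicWeight p * (dlen p)⁻¹) ^ 2 * (dlen p * a) ≤ a := by
  have h := dlen_pos p
  calc (dyadicWeight p * (dlen p)⁻¹) ^ 2 * (dlen p * a)
      = dyadicWeight p ^ 2 * (dlen p)⁻¹ * a := by field_simp
    _ ≤ dlen p * (dlen p)⁻¹ * a := by gcongr; exact dyadicWeight_sq_le p
    _ = a := by field_simp

theorem abs_pairSum_walshSeq_le_one {u g : (ℤ × ℤ) → ℝ → ℝ} (hu : u ∈ Adm) (hg : g ∈ Adm) :
    |pairSum walshSeq u g| ≤ 1 := by
  classical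
  set S := hu.2.1.toFinset ∪ hg.2.1.toFinset with hS
  have hSu : ∀ p, p ∉ S → u p = 0 := by
    intro p hp
    by_contra h
    exact hp (by simp [hS, h])
  have hSg : ∀ p, p ∉ S → g p = 0 := by
    intro p hp
    by_contra h
    exact hp (by simp [hS, h])
  let c : ℤ × ℤ → ℝ := fun p => dyadicWeight p * (dlen p)⁻¹
  let α : ℤ × ℤ → ℝ × ℝ → ℝ := fun p z => c p * ((dyadic p).indicator 1 z.1 * u p z.2)
  let β : ℤ × ℤ → ℝ × ℝ → ℝ := fun q z => c q * (g q z.1 * (dyadic q).indicator 1 z.2)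
  have hαβ : ∀ p q z, walshBlock (levelLabel p.1) (levelLabel q.1) * α p z * β q z =
      walshBlock (levelLabel p.1) (levelLabel q.1) * c p * c q *
        ((dyadic p).indicator (g q) z.1 * (dyadic q).indicator (u p) z.2) := by
    intro p q z
    simp only [α, β, Set.indicator, Pi.one_apply]
    split_ifs <;> ring
  have hα2 : ∀ p z, α p z ^ 2 = c p ^ 2 * ((dyadic p).indicator 1 z.1 * u p z.2 ^ 2) := by
    intro p z
    simp only [α, Set.indicator, Pi.one_apply]
    split_ifs <;> ring
  have hβ2 : ∀ q z, β q z ^ 2 = c q ^ 2 * (g q z.1 ^ 2 * (dyadic q).indicator 1 z.2) := by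
    intro p z
    simp only [β, Set.indicator, Pi.one_apply]
    split_ifs <;> ring
  have hIαβ : ∀ p q, Integrable
      (fun z => walshBlock (levelLabel p.1) (levelLabel q.1) * α p z * β q z)
      ((volume : Measure ℝ).prod (volume : Measure ℝ)) := by
    intro p q
    simp only [hαβ]
    exact (((integrable_indicator_iff (measurableSet_dyadic p)).2
      (integrableOn_dyadic (hg.1 q) p)).mul_prod
      ((integrable_indicator_iff (measurableSet_dyadic q)).2
      (integrableOn_dyadic (hu.1 p) q))).const_mul _
  have hIα : ∀ p, Integrable (fun z => α p z ^ 2)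
      ((volume : Measure ℝ).prod (volume : Measure ℝ)) := by
    intro p
    simp only [hα2]
    exact ((integrable_indicator_dyadic p).mul_prod (hu.1 p).integrable_sq).const_mul _
  have hIβ : ∀ q, Integrable (fun z => β q z ^ 2)
      ((volume : Measure ℝ).prod (volume : Measure ℝ)) := by
    intro q
    simp only [hβ2]
    exact ((hg.1 q).integrable_sq.mul_prod (integrable_indicator_dyadic q)).const_mul _
  have hsum : pairSum walshSeq u g = ∫ z, (∑ p ∈ S, ∑ q ∈ S,
      walshBlock (levelLabel p.1) (levelLabel q.1) * α p z * β q z)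
        ∂((volume : Measure ℝ).prod (volume : Measure ℝ)) := by
    rw [pairSum_eq_sum _ hSu hSg, integral_finsetSum _
      fun p _ => integrable_finsetSum _ fun q _ => hIαβ p q]
    refine Finset.sum_congr rfl fun p _ => ?_
    rw [integral_finsetSum _ fun q _ => hIαβ p q]
    refine Finset.sum_congr rfl fun q _ => ?_
    simp only [hαβ]
    rw [integral_const_mul, integral_prod_mul, integral_indicator (measurableSet_dyadic p),
      integral_indicator (measurableSet_dyadic q)]
    simp only [walshSeq, avg, c]
    ring
  have hintα : ∀ p, ∫ z, α p z ^ 2 ∂((volume : Measure ℝ).prod (volume : Measure ℝ)) ≤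
      ∫ x, u p x ^ 2 := by
    intro p
    simp only [hα2]
    rw [integral_const_mul, integral_prod_mul _ (fun y => u p y ^ 2), integral_indicator_dyadic]
    exact dyadicWeight_mul_le p (integral_nonneg fun _ => sq_nonneg _)
  have hintβ : ∀ q, ∫ z, β q z ^ 2 ∂((volume : Measure ℝ).prod (volume : Measure ℝ)) ≤
      ∫ x, g q x ^ 2 := by
    intro q
    simp only [hβ2]
    rw [integral_const_mul, integral_prod_mul (fun y => g q y ^ 2), integral_indicator_dyadic,
      mul_comm (∫ _, _)]
    exact dyadicWeight_mul_le q (integral_nonneg fun _ => sq_nonneg _)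
  have hpt : ∀ z, |∑ p ∈ S, ∑ q ∈ S,
      walshBlock (levelLabel p.1) (levelLabel q.1) * α p z * β q z| ≤
      (∑ p ∈ S, α p z ^ 2 + ∑ q ∈ S, β q z ^ 2) / 2 := by
    intro z
    have hc : ∀ p, c p ≠ 0 → 0 ≤ p.1 := by
      intro p hp
      by_contra h
      exact hp (by simp [c, dyadicWeight, h])
    refine abs_sum_walshBlock_le S (fun p => levelLabel p.1) (fun p => α p z) (fun q => β q z)
      ?_ ?_
    · intro p _ q _ hp hq h
      simp only [α, mul_ne_zero_iff, Set.indicator_apply_ne_zero] at hp hq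
      exact eq_of_mem_dyadic hp.2.1.1 hq.2.1.1 (levelLabel_inj (hc p hp.1) (hc q hq.1) h)
    · intro p _ q _ hp hq h
      simp only [β, mul_ne_zero_iff, Set.indicator_apply_ne_zero] at hp hq
      exact eq_of_mem_dyadic hp.2.2.1 hq.2.2.1 (levelLabel_inj (hc p hp.1) (hc q hq.1) h)
  have hIα' := integrable_finsetSum S fun p _ => hIα p
  have hIβ' := integrable_finsetSum S fun q _ => hIβ q
  rw [hsum]
  calc _ ≤ ∫ z, |∑ p ∈ S, ∑ q ∈ S,
        walshBlock (levelLabel p.1) (levelLabel q.1) * α p z * β q z|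
          ∂((volume : Measure ℝ).prod (volume : Measure ℝ)) := abs_integral_le_integral_abs
    _ ≤ ∫ z, (∑ p ∈ S, α p z ^ 2 + ∑ q ∈ S, β q z ^ 2) / 2
          ∂((volume : Measure ℝ).prod (volume : Measure ℝ)) :=
        integral_mono (integrable_finsetSum _ fun p _ => integrable_finsetSum _
          fun q _ => hIαβ p q).abs ((hIα'.add hIβ').div_const 2) hpt
    _ = (∑ p ∈ S, ∫ z, α p z ^ 2 ∂((volume : Measure ℝ).prod (volume : Measure ℝ)) +
          ∑ q ∈ S, ∫ z, β q z ^ 2 ∂((volume : Measure ℝ).prod (volume : Measure ℝ))) / 2 := by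
        rw [integral_div, integral_add hIα' hIβ', integral_finsetSum _ fun p _ => hIα p,
          integral_finsetSum _ fun q _ => hIβ q]
    _ ≤ (∑ p ∈ S, (∫ x, u p x ^ 2) + ∑ q ∈ S, ∫ x, g q x ^ 2) / 2 := by
        gcongr with p _ q _
        · exact hintα p
        · exact hintβ q
    _ = 1 := by
        rw [sum_integral_sq_eq_one hu hSu, sum_integral_sq_eq_one hg hSg]
        norm_num

/-- The dyadic subintervals of `[0, 1)` on the levels labelled by the `n`-th Walsh block. -/
def blockIntervals (n : ℕ) : Finset (ℤ × ℤ) :=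
  ((Finset.range (2 * n)).powerset.sigma
    fun a => Finset.range (2 ^ Denumerable.eqv (ℕ × Finset ℕ) (n, a))).image
      fun t => ((Denumerable.eqv (ℕ × Finset ℕ) (n, t.1) : ℤ), (t.2 : ℤ))

theorem mem_blockIntervals {n : ℕ} {p : ℤ × ℤ} (hp : p ∈ blockIntervals n) :
    0 ≤ p.1 ∧ dyadic p ⊆ Set.Ico 0 1 ∧
      ∃ a, a ⊆ Finset.range (2 * n) ∧ levelLabel p.1 = (n, a) := by
  simp only [blockIntervals, Finset.mem_image, Finset.mem_sigma, Finset.mem_powerset,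
    Finset.mem_range] at hp
  obtain ⟨⟨a, k⟩, ⟨ha, hk⟩, rfl⟩ := hp
  refine ⟨by positivity, fun x hx => ?_, a, ha, by simp [levelLabel]⟩
  simp only at hk
  simp only [dyadic, Set.mem_Ico, Int.cast_natCast, zpow_neg, zpow_natCast] at hx
  refine ⟨le_trans (by positivity) hx.1, hx.2.trans_le ?_⟩
  rw [inv_mul_le_one₀ (by positivity)]
  exact_mod_cast hk

theorem sum_blockIntervals_dlen (n : ℕ) : ∑ p ∈ blockIntervals n, dlen p = (2 ^ n) ^ 2 := by
  rw [blockIntervals, Finset.sum_image]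
  · rw [Finset.sum_sigma]
    simp [dlen, ← pow_mul, mul_comm]
  · rintro ⟨a, k⟩ - ⟨b, l⟩ - h
    simp only [Prod.mk.injEq, Nat.cast_inj, EmbeddingLike.apply_eq_iff_eq, true_and] at h
    obtain ⟨rfl, rfl⟩ := h
    rfl

/-- The height of the `p`-th test function for the `n`-th Walsh block. -/
def testHeight (n : ℕ) (p : ℤ × ℤ) : ℝ :=
  if p ∈ blockIntervals n then (2 ^ n)⁻¹ * √(dlen p) else 0

theorem testHeight_nonneg (n : ℕ) (p : ℤ × ℤ) : 0 ≤ testHeight n p := by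
  unfold testHeight
  split_ifs <;> positivity

/-- The test functions, supported on `[0, 1)`, for the `n`-th Walsh block. -/
def testFamily (n : ℕ) (p : ℤ × ℤ) : ℝ → ℝ :=
  (Set.Ico 0 1).indicator fun _ => testHeight n p

theorem testFamily_eq_zero {n : ℕ} {p : ℤ × ℤ} (hp : p ∉ blockIntervals n) :
    testFamily n p = 0 := by
  ext x
  simp [testFamily, testHeight, hp]

theorem testFamily_mem_Adm (n : ℕ) : testFamily n ∈ Adm := by
  refine ⟨fun p => memLp_indicator_const 2 measurableSet_Ico _ (Or.inr (by simp)), ?_, ?_⟩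
  · refine (blockIntervals n).finite_toSet.subset fun p hp => ?_
    by_contra h
    exact hp (testFamily_eq_zero h)
  · rw [tsum_eq_sum (s := blockIntervals n)]
    · have h : ∀ p ∈ blockIntervals n,
          ∫ x, testFamily n p x ^ 2 = ((2 ^ n)⁻¹) ^ 2 * dlen p := by
        intro p hp
        have : (fun x => testFamily n p x ^ 2) =
            (Set.Ico 0 1).indicator fun _ => testHeight n p ^ 2 := by
          ext x
          simp only [testFamily, Set.indicator]
          split_ifs <;> simp
        rw [this, integral_indicator_const _ measurableSet_Ico]
        simp [testHeight, hp, mul_pow, Real.sq_sqrt (dlen_pos p).le]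
      rw [Finset.sum_congr rfl h, ← Finset.mul_sum, sum_blockIntervals_dlen]
      field_simp
    · intro p hp
      simp [testFamily_eq_zero hp]

theorem avg_testFamily_nonneg (n : ℕ) (p q : ℤ × ℤ) : 0 ≤ avg (testFamily n p) q :=
  mul_nonneg (inv_nonneg.2 (dlen_pos q).le)
    (integral_nonneg fun _ => Set.indicator_nonneg (fun _ _ => testHeight_nonneg n p) _)

theorem avg_testFamily {n : ℕ} (p : ℤ × ℤ) {q : ℤ × ℤ} (hq : q ∈ blockIntervals n) :
    avg (testFamily n p) q = testHeight n p := by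
  have h := dlen_pos q
  have h1 : ∫ x in dyadic q, testFamily n p x = ∫ _ in dyadic q, testHeight n p :=
    setIntegral_congr_fun (measurableSet_dyadic q) fun x hx =>
      Set.indicator_of_mem ((mem_blockIntervals hq).2.1 hx) _
  rw [avg, h1, setIntegral_const, measureReal_def, volume_dyadic, ENNReal.toReal_ofReal h.le,
    smul_eq_mul, inv_mul_cancel_left₀ h.ne']

theorem abs_walshSeq {n : ℕ} {p q : ℤ × ℤ} (hp : p ∈ blockIntervals n)
    (hq : q ∈ blockIntervals n) :
    |walshSeq p q| = (2 ^ n)⁻¹ * (√(dlen p) * √(dlen q)) := by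
  obtain ⟨hp0, -, a, ha, hpa⟩ := mem_blockIntervals hp
  obtain ⟨hq0, -, b, hb, hqb⟩ := mem_blockIntervals hq
  have : |(2 ^ n : ℝ)⁻¹| = (2 ^ n)⁻¹ := abs_of_pos (by positivity)
  rw [walshSeq, hpa, hqb, walshBlock, if_pos ⟨rfl, ha, hb⟩, abs_mul, abs_mul _ (walshSign _ _),
    abs_walshSign, this, abs_of_nonneg (mul_nonneg (dyadicWeight_nonneg p) (dyadicWeight_nonneg q)),
    dyadicWeight, dyadicWeight, if_pos hp0, if_pos hq0]
  ring

theorem pairSum_abs_walshSeq (n : ℕ) :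
    pairSum (fun p q => |walshSeq p q|) (testFamily n) (testFamily n) = 2 ^ n := by
  rw [pairSum_eq_sum _ (fun _ => testFamily_eq_zero) (fun _ => testFamily_eq_zero)]
  have h : ∀ p ∈ blockIntervals n, ∀ q ∈ blockIntervals n,
      |walshSeq p q| * avg (testFamily n q) p * avg (testFamily n p) q =
        ((2 ^ n)⁻¹) ^ 3 * (dlen p * dlen q) := by
    intro p hp q hq
    rw [abs_walshSeq hp hq, avg_testFamily q hp, avg_testFamily p hq, testHeight, testHeight,
      if_pos hp, if_pos hq]
    nth_rewrite 3 [← Real.mul_self_sqrt (dlen_pos p).le]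
    nth_rewrite 3 [← Real.mul_self_sqrt (dlen_pos q).le]
    ring
  rw [Finset.sum_congr rfl fun p hp => Finset.sum_congr rfl (h p hp)]
  simp only [← Finset.mul_sum, ← Finset.sum_mul]
  rw [sum_blockIntervals_dlen]
  field_simp

theorem eq_top_of_forall_two_pow_le {a : ℝ≥0∞} (h : ∀ n : ℕ, ENNReal.ofReal (2 ^ n) ≤ a) :
    a = ⊤ := by
  refine ENNReal.eq_top_of_forall_nnreal_le fun r => ?_
  obtain ⟨n, hn⟩ := pow_unbounded_of_one_lt (r : ℝ) one_lt_two
  refine le_trans ?_ (h n)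
  rw [← ENNReal.ofReal_coe_nnreal]
  exact ENNReal.ofReal_le_ofReal hn.le

/-- there is a sequence `λ` with `‖λ‖_X < ∞` but `‖λ‖_{X'} = ∞`; equivalently
`P_λ` is bounded on `L²(ℝ²)` (i.e. `‖λ‖_X < ∞`) while `P_{|λ|}` is unbounded
(i.e. `‖(|λ_{IJ}|)‖_X = ∞`): conditional boundedness does not imply unconditional
boundedness. -/
theorem exists_bounded_not_unconditionally_bounded :
    ∃ lam : ParaSeq, Xnorm lam < ⊤ ∧ Xprime lam = ⊤ ∧ Xnorm (fun p q => |lam p q|) = ⊤ := by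
  refine ⟨walshSeq, ?_, ?_, ?_⟩
  · refine lt_of_le_of_lt ?_ ENNReal.one_lt_top
    refine iSup₂_le fun u g => ENNReal.ofReal_le_one.2 ?_
    exact abs_pairSum_walshSeq_le_one u.2 g.2
  · refine eq_top_of_forall_two_pow_le fun n => ?_
    refine le_iSup₂_of_le ⟨_, testFamily_mem_Adm n⟩ ⟨_, testFamily_mem_Adm n⟩ ?_
    rw [← pairSum_abs_walshSeq n, pairSum]
    simp only [abs_mul, abs_of_nonneg (avg_testFamily_nonneg n _ _), le_refl]
  · refine eq_top_of_forall_two_pow_le fun n => ?_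
    refine le_iSup₂_of_le ⟨_, testFamily_mem_Adm n⟩ ⟨_, testFamily_mem_Adm n⟩ ?_
    rw [pairSum_abs_walshSeq n]
    exact ENNReal.ofReal_le_ofReal (le_abs_self _)

end
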